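/- arXiv:2312.06212 — 8 statements merged into one kernel-verified Lean document; each statement's English description precedes it below -/
import Mathlib

section
/- Let X be the random variable that takes the value −√(3/5) with probability 1/2 and, with probability 1/2, is uniformly distributed on the interval (−√(3/5), 3√(3/5)) (the normalized boundary inflated uniform distribution with point mass 1/2). Then X has mean 0, variance 1, and for every integer k with 1 ≤ k ≤ 8 its k-th moment equals ν_k = E(X^k) = (√(3/5))^k · (3^{k+1} + (4k+5)(−1)^k) / (8(k+1)). In particular ν₃ = (6/5)√(3/5), ν₄ = 297/125, ν₅ = (132/25)√(3/5), ν₆ = 7479/875, ν₇ = (2754/125)√(3/5), ν₈ = 4437/125. -/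
open MeasureTheory

/-- The `k`-th moment of the mixture of an atom at `-s` and the uniform law on `(-s, 3s)`, each with
weight `1/2`. -/
theorem integral_pow_half_dirac_add_half_uniform {s : ℝ} (hs : 0 < s) (k : ℕ) :
    ∫ x, x ^ k ∂((1 / 2 : ENNReal) • Measure.dirac (-s)
      + ENNReal.ofReal (1 / (8 * s)) • volume.restrict (Set.Ioo (-s) (3 * s)))
      = s ^ k * ((3 : ℝ) ^ (k + 1) + (4 * (k : ℝ) + 5) * (-1 : ℝ) ^ k) / (8 * ((k : ℝ) + 1)) := by
  have hle : -s ≤ 3 * s := by linarith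
  have hdirac : Integrable (fun x : ℝ => x ^ k) ((1 / 2 : ENNReal) • Measure.dirac (-s)) :=
    (integrable_dirac (by simp)).smul_measure (by simp)
  have hunif : Integrable (fun x : ℝ => x ^ k)
      (ENNReal.ofReal (1 / (8 * s)) • volume.restrict (Set.Ioo (-s) (3 * s))) :=
    ((continuous_pow k).integrableOn_Icc.mono_set Set.Ioo_subset_Icc_self).integrable.smul_measure
      ENNReal.ofReal_ne_top
  rw [integral_add_measure hdirac hunif, integral_smul_measure, integral_smul_measure,
    integral_dirac, ← integral_Ioc_eq_integral_Ioo, ← intervalIntegral.integral_of_le hle,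
    integral_pow, ENNReal.toReal_ofReal (by positivity), neg_pow s k, neg_pow s (k + 1), mul_pow]
  simp only [smul_eq_mul, one_div, ENNReal.toReal_inv, ENNReal.toReal_ofNat]
  field_simp
  ring

/-- **Moments of the normalized boundary inflated uniform distribution with point mass 1/2.**
`X` equals `−√(3/5)` with probability `1/2` and is uniform on `(−√(3/5), 3√(3/5))` with
probability `1/2`.  Then `X` has mean `0`, variance `1` and `k`-th moment
`ν_k = (√(3/5))^k (3^{k+1} + (4k+5)(−1)^k)/(8(k+1))` for `1 ≤ k ≤ 8`. -/
theorem biu_half_moments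
    (s : ℝ) (hs : s = Real.sqrt (3 / 5))
    (μ : Measure ℝ)
    (hμ : μ = (1 / 2 : ENNReal) • Measure.dirac (-s)
      + ENNReal.ofReal (1 / (8 * s)) • volume.restrict (Set.Ioo (-s) (3 * s))) :
    (∫ x, x ∂μ) = 0 ∧
    (∫ x, (x - ∫ y, y ∂μ) ^ 2 ∂μ) = 1 ∧
    (∀ k : ℕ, 1 ≤ k → k ≤ 8 →
      (∫ x, x ^ k ∂μ)
        = s ^ k * ((3 : ℝ) ^ (k + 1) + (4 * (k : ℝ) + 5) * (-1 : ℝ) ^ k)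
            / (8 * ((k : ℝ) + 1))) ∧
    (∫ x, x ^ 3 ∂μ) = 6 / 5 * s ∧
    (∫ x, x ^ 4 ∂μ) = 297 / 125 ∧
    (∫ x, x ^ 5 ∂μ) = 132 / 25 * s ∧
    (∫ x, x ^ 6 ∂μ) = 7479 / 875 ∧
    (∫ x, x ^ 7 ∂μ) = 2754 / 125 * s ∧
    (∫ x, x ^ 8 ∂μ) = 4437 / 125 := by
  have hpos : 0 < s := by rw [hs]; positivity
  have hsq : s ^ 2 = 3 / 5 := by rw [hs]; exact Real.sq_sqrt (by norm_num)
  have hmoment (k : ℕ) := integral_pow_half_dirac_add_half_uniform hpos k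
  rw [← hμ] at hmoment
  have hmean : ∫ x, x ∂μ = 0 := by simpa using hmoment 1 |>.trans (by norm_num)
  have hpow_four : s ^ 4 = 9 / 25 := by rw [show s ^ 4 = (s ^ 2) ^ 2 by ring, hsq]; norm_num
  have hpow_six : s ^ 6 = 27 / 125 := by rw [show s ^ 6 = (s ^ 2) ^ 3 by ring, hsq]; norm_num
  have hpow_eight : s ^ 8 = 81 / 625 := by rw [show s ^ 8 = (s ^ 2) ^ 4 by ring, hsq]; norm_num
  refine ⟨hmean, ?_, fun k _ _ => hmoment k, ?_, ?_, ?_, ?_, ?_, ?_⟩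
  · simp only [hmean, sub_zero]
    rw [hmoment, hsq]; norm_num
  · rw [hmoment, pow_succ s 2, hsq]; push_cast; ring
  · rw [hmoment, hpow_four]; norm_num
  · rw [hmoment, pow_succ s 4, hpow_four]; push_cast; ring
  · rw [hmoment, hpow_six]; norm_num
  · rw [hmoment, pow_succ s 6, hpow_six]; push_cast; ring
  · rw [hmoment, hpow_eight]; norm_num
end

section
/- Let X be the random variable that takes the value −√(3/5) with probability 1/2 and, with probability 1/2, is uniformly distributed on (−√(3/5), 3√(3/5)), with k-th moments ν_k = E(X^k), skewness τ = ν₃, kurtosis κ = ν₄ and Δ = ν₄ − ν₃². Then the quantity ς² = 4Δ³ − Δ² − (3ν₃⁴ + 16ν₃² − 8ν₃ν₅ + 4ν₆)Δ + ν₃⁶ − 4ν₃⁴ − 4ν₃³ν₅ + 2ν₃²(2 + 3ν₆) + 4ν₃(ν₅ − ν₇) + ν₈ equals 2^{16} · 3² / (5⁷ · 7). -/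
open MeasureTheory

/-- The moments of the mixture, with weight `1/2` each, of the point mass at `-s` and the uniform
distribution on `(-s, 3s)`. -/
theorem integral_pow_boundary_inflated_uniform {s : ℝ} (hs : 0 < s) (k : ℕ) :
    ∫ x, x ^ k ∂((1 / 2 : ENNReal) • Measure.dirac (-s)
      + ENNReal.ofReal (1 / (8 * s)) • volume.restrict (Set.Ioo (-s) (3 * s)))
    = ((-1) ^ k / 2 + (3 ^ (k + 1) - (-1) ^ (k + 1)) / (8 * (k + 1))) * s ^ k := by
  have h_uniform : Integrable (fun x : ℝ => x ^ k) (volume.restrict (Set.Ioo (-s) (3 * s))) :=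
    ((continuous_pow k).integrableOn_Icc).mono_set Set.Ioo_subset_Icc_self
  have h_dirac : Integrable (fun x : ℝ => x ^ k) (Measure.dirac (-s)) :=
    integrable_dirac (by simp)
  rw [integral_add_measure (h_dirac.smul_measure (by simp))
      (h_uniform.smul_measure ENNReal.ofReal_ne_top),
    integral_smul_measure, integral_smul_measure, integral_dirac,
    ← integral_Ioc_eq_integral_Ioo, ← intervalIntegral.integral_of_le (by linarith),
    integral_pow, ENNReal.toReal_ofReal (by positivity), neg_pow s k, neg_pow s (k + 1), mul_pow]
  have hk : (k : ℝ) + 1 ≠ 0 := by positivity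
  simp only [one_div, ENNReal.toReal_inv, ENNReal.toReal_ofNat, smul_eq_mul]
  field_simp
  ring

/-- **Limit variance of the test statistic at the normalized boundary inflated uniform
distribution with point mass 1/2.**  With `ν_k = E(X^k)` and `Δ = ν₄ − ν₃²`, the asymptotic
variance `ς²` equals `2¹⁶·3²/(5⁷·7)`. -/
theorem biu_half_limit_variance
    (s : ℝ) (hs : s = Real.sqrt (3 / 5))
    (μ : Measure ℝ)
    (hμ : μ = (1 / 2 : ENNReal) • Measure.dirac (-s)
      + ENNReal.ofReal (1 / (8 * s)) • volume.restrict (Set.Ioo (-s) (3 * s)))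
    (ν : ℕ → ℝ) (hν : ∀ k, ν k = ∫ x, x ^ k ∂μ)
    (Δ : ℝ) (hΔ : Δ = ν 4 - ν 3 ^ 2) :
    4 * Δ ^ 3 - Δ ^ 2
      - (3 * ν 3 ^ 4 + 16 * ν 3 ^ 2 - 8 * ν 3 * ν 5 + 4 * ν 6) * Δ
      + ν 3 ^ 6 - 4 * ν 3 ^ 4 - 4 * ν 3 ^ 3 * ν 5 + 2 * ν 3 ^ 2 * (2 + 3 * ν 6)
      + 4 * ν 3 * (ν 5 - ν 7) + ν 8
    = 2 ^ 16 * 3 ^ 2 / (5 ^ 7 * 7) := by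
  have hs_pos : 0 < s := hs ▸ Real.sqrt_pos.mpr (by norm_num)
  have hs_sq : s ^ 2 = 3 / 5 := hs ▸ Real.sq_sqrt (by norm_num)
  have hs4 : s ^ 4 = (3 / 5) ^ 2 := by rw [← hs_sq]; ring
  have hs6 : s ^ 6 = (3 / 5) ^ 3 := by rw [← hs_sq]; ring
  have hs8 : s ^ 8 = (3 / 5) ^ 4 := by rw [← hs_sq]; ring
  have hs3 : s ^ 3 = 3 / 5 * s := by rw [← hs_sq]; ring
  have hs5 : s ^ 5 = (3 / 5) ^ 2 * s := by rw [← hs_sq]; ring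
  have hs7 : s ^ 7 = (3 / 5) ^ 3 * s := by rw [← hs_sq]; ring
  have h_moment (k : ℕ) := (hν k).trans (hμ ▸ integral_pow_boundary_inflated_uniform hs_pos k)
  rw [hΔ, h_moment 3, h_moment 4, h_moment 5, h_moment 6, h_moment 7, h_moment 8,
    hs3, hs4, hs5, hs6, hs7, hs8]
  norm_num
  ring_nf
  rw [hs4, hs_sq]
  norm_num
end

section
/- Let 0 < p ≤ 1 and let X = BU where B and U are independent, B Bernoulli distributed with success probability p and U uniform on the unit interval (the BIU(p) distribution). Then X has mean p/2 and variance p(4−3p)/12, and for every integer k with 1 ≤ k ≤ 8 the k-th reduced moment ν_k = E(((X−EX)/√(Var X))^k) equals (√(3p/(4−3p)))^k · { (−1)^k (1−p) + ((2−p)^{k+1} − (−p)^{k+1}) / (2(k+1) p^{k−1}) }. -/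
open MeasureTheory ProbabilityTheory

/-- The law of a product of a Bernoulli(`p`) variable and an independent variable with law `ν` is
the mixture of `δ₀` and `ν` with weights `1 - p` and `p`. -/
theorem map_bernoulli_mul
    {Ω : Type*} [MeasurableSpace Ω] {P : Measure Ω} [IsProbabilityMeasure P] {p : ℝ}
    {B U : Ω → ℝ} {ν : Measure ℝ} [IsProbabilityMeasure ν]
    (hB : Measurable B) (hU : Measurable U) (hindep : IndepFun B U P)
    (hBlaw : Measure.map B P
      = ENNReal.ofReal (1 - p) • Measure.dirac 0 + ENNReal.ofReal p • Measure.dirac 1)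
    (hUlaw : Measure.map U P = ν) :
    Measure.map (fun ω => B ω * U ω) P
      = ENNReal.ofReal (1 - p) • Measure.dirac 0 + ENNReal.ofReal p • ν := by
  have hmul : Measurable fun z : ℝ × ℝ => z.1 * z.2 := measurable_fst.mul measurable_snd
  have hjoint := (indepFun_iff_map_prod_eq_prod_map_map hB.aemeasurable hU.aemeasurable).1 hindep
  have hcomp : (fun ω => B ω * U ω) = (fun z : ℝ × ℝ => z.1 * z.2) ∘ fun ω => (B ω, U ω) := rfl
  rw [hcomp, ← Measure.map_map hmul (hB.prodMk hU), hjoint, hBlaw, hUlaw, Measure.add_prod,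
    Measure.prod_smul_left, Measure.prod_smul_left, Measure.dirac_prod, Measure.dirac_prod,
    Measure.map_add _ _ hmul, Measure.map_smul, Measure.map_smul,
    Measure.map_map hmul measurable_prodMk_left, Measure.map_map hmul measurable_prodMk_left]
  simp [Function.comp_def]

/-- Expectation of a continuous function of a BIU(`p`) variable. -/
theorem integral_comp_biu
    {Ω : Type*} [MeasurableSpace Ω] {P : Measure Ω} {p : ℝ} (hp0 : 0 ≤ p) (hp1 : p ≤ 1)
    {X : Ω → ℝ} (hX : Measurable X)
    (hXlaw : Measure.map X P = ENNReal.ofReal (1 - p) • Measure.dirac 0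
      + ENNReal.ofReal p • volume.restrict (Set.Icc (0 : ℝ) 1))
    {f : ℝ → ℝ} (hf : Continuous f) :
    ∫ ω, f (X ω) ∂P = (1 - p) * f 0 + p * ∫ u in (0 : ℝ)..1, f u := by
  have hdirac : Integrable f (Measure.dirac (0 : ℝ)) :=
    integrable_dirac (by simp [enorm_lt_top])
  have hunif : Integrable f (volume.restrict (Set.Icc (0 : ℝ) 1)) :=
    hf.continuousOn.integrableOn_Icc
  rw [← integral_map hX.aemeasurable hf.aestronglyMeasurable, hXlaw,
    integral_add_measure (hdirac.smul_measure ENNReal.ofReal_ne_top)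
      (hunif.smul_measure ENNReal.ofReal_ne_top),
    integral_smul_measure, integral_smul_measure, integral_dirac,
    ENNReal.toReal_ofReal (sub_nonneg.2 hp1), ENNReal.toReal_ofReal hp0,
    integral_Icc_eq_integral_Ioc, ← intervalIntegral.integral_of_le zero_le_one,
    smul_eq_mul, smul_eq_mul]

/-- The `k`-th moment of the uniform distribution on `[0, 1]` about the point `a`. -/
theorem integral_sub_const_pow (a : ℝ) (k : ℕ) :
    ∫ u in (0 : ℝ)..1, (u - a) ^ k = ((1 - a) ^ (k + 1) - (-a) ^ (k + 1)) / (k + 1) := by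
  rw [intervalIntegral.integral_comp_sub_right (fun u => u ^ k) a, integral_pow, zero_sub]

/-- The ratio of mean to standard deviation of the BIU(`p`) distribution. -/
theorem biu_mean_div_sqrt_variance {p : ℝ} (hp0 : 0 < p) :
    p / 2 / Real.sqrt (p * (4 - 3 * p) / 12) = Real.sqrt (3 * p / (4 - 3 * p)) := by
  have hsq : 3 * p / (4 - 3 * p) = (p / 2) ^ 2 / (p * (4 - 3 * p) / 12) := by
    field_simp
    ring
  rw [hsq, Real.sqrt_div (sq_nonneg _), Real.sqrt_sq (by positivity)]

/-- **Reduced moments of the BIU(p) distribution.**  For `X = B·U` with `B` Bernoulli(`p`) and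
`U` uniform on `[0,1]` independent, `X` has mean `p/2`, variance `p(4−3p)/12`, and for
`1 ≤ k ≤ 8` the `k`-th reduced moment equals
`(√(3p/(4−3p)))^k ((−1)^k(1−p) + ((2−p)^{k+1} − (−p)^{k+1})/(2(k+1)p^{k−1}))`. -/
theorem biu_reduced_moments
    {Ω : Type*} [MeasurableSpace Ω] (P : Measure Ω) [IsProbabilityMeasure P]
    (p : ℝ) (hp0 : 0 < p) (hp1 : p ≤ 1)
    (B U : Ω → ℝ) (hB : Measurable B) (hU : Measurable U)
    (hindep : IndepFun B U P)
    (hBlaw : Measure.map B P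
      = ENNReal.ofReal (1 - p) • Measure.dirac 0 + ENNReal.ofReal p • Measure.dirac 1)
    (hUlaw : Measure.map U P = volume.restrict (Set.Icc (0 : ℝ) 1))
    (X : Ω → ℝ) (hX : X = fun ω => B ω * U ω) :
    (∫ ω, X ω ∂P) = p / 2 ∧
    (∫ ω, (X ω - ∫ ω', X ω' ∂P) ^ 2 ∂P) = p * (4 - 3 * p) / 12 ∧
    (∀ k : ℕ, 1 ≤ k → k ≤ 8 →
      (∫ ω, ((X ω - ∫ ω', X ω' ∂P)
          / Real.sqrt (∫ ω', (X ω' - ∫ ω'', X ω'' ∂P) ^ 2 ∂P)) ^ k ∂P)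
        = (Real.sqrt (3 * p / (4 - 3 * p))) ^ k
          * ((-1 : ℝ) ^ k * (1 - p)
            + ((2 - p) ^ (k + 1) - (-p) ^ (k + 1)) / (2 * ((k : ℝ) + 1) * p ^ (k - 1)))) := by
  have hXm : Measurable X := hX ▸ hB.mul hU
  have : IsProbabilityMeasure (volume.restrict (Set.Icc (0 : ℝ) 1)) :=
    hUlaw ▸ Measure.isProbabilityMeasure_map hU.aemeasurable
  have hXlaw := map_bernoulli_mul hB hU hindep hBlaw hUlaw
  rw [← hX] at hXlaw
  have hmean : ∫ ω, X ω ∂P = p / 2 := by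
    rw [integral_comp_biu hp0.le hp1 hXm hXlaw (f := fun x => x) continuous_id, integral_id]
    ring
  have hcentral (k : ℕ) : ∫ ω, (X ω - p / 2) ^ k ∂P = (1 - p) * (-(p / 2)) ^ k
      + p * (((1 - p / 2) ^ (k + 1) - (-(p / 2)) ^ (k + 1)) / (k + 1)) := by
    rw [integral_comp_biu hp0.le hp1 hXm hXlaw (f := fun x => (x - p / 2) ^ k) (by fun_prop),
      integral_sub_const_pow, zero_sub]
  have hvar : ∫ ω, (X ω - p / 2) ^ 2 ∂P = p * (4 - 3 * p) / 12 := by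
    rw [hcentral]
    push_cast
    ring
  rw [hmean, hvar]
  refine ⟨rfl, rfl, fun k hk _ => ?_⟩
  obtain ⟨m, rfl⟩ : ∃ m, k = m + 1 := ⟨k - 1, by omega⟩
  simp_rw [div_pow (_ - _)]
  rw [integral_div, hcentral, ← biu_mean_div_sqrt_variance hp0, div_pow (p / 2), div_mul_eq_mul_div]
  congr 1
  have hone : 1 - p / 2 = (2 - p) / 2 := by ring
  have hneg : -(p / 2) = -p / 2 := by ring
  have hm : (m : ℝ) + 1 + 1 ≠ 0 := by positivity
  rw [hone, hneg, Nat.add_sub_cancel, neg_pow p, div_pow, div_pow, div_pow, div_pow, neg_pow p]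
  push_cast
  field_simp
  ring
end

section
/- Let 0 < p < 1 and let X have the BIU(p) distribution, with reduced moments ν_k = E(((X−EX)/√(Var X))^k) and Δ = ν₄ − ν₃². Then the asymptotic variance ς²(p) = 4Δ³ − Δ² − (3ν₃⁴ + 16ν₃² − 8ν₃ν₅ + 4ν₆)Δ + ν₃⁶ − 4ν₃⁴ − 4ν₃³ν₅ + 2ν₃²(2 + 3ν₆) + 4ν₃(ν₅ − ν₇) + ν₈ equals 1152(2446 − 11229p + 21744p² − 22080p³ + 11640p⁴ − 2520p⁵) / (875 p³ (4−3p)⁸). -/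
open MeasureTheory ProbabilityTheory

/-- The law of a product `B * U` with `B` Bernoulli and `U` uniform on `[0, 1]`, independent. -/
theorem map_bernoulli_mul_uniform {Ω : Type*} [MeasurableSpace Ω] {P : Measure Ω}
    [IsProbabilityMeasure P] {p : ℝ} {B U : Ω → ℝ} (hB : Measurable B) (hU : Measurable U)
    (hindep : IndepFun B U P)
    (hBlaw : Measure.map B P
      = ENNReal.ofReal (1 - p) • Measure.dirac 0 + ENNReal.ofReal p • Measure.dirac 1)
    (hUlaw : Measure.map U P = volume.restrict (Set.Icc (0 : ℝ) 1)) :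
    Measure.map (fun ω => B ω * U ω) P
      = ENNReal.ofReal (1 - p) • Measure.dirac 0
        + ENNReal.ofReal p • volume.restrict (Set.Icc (0 : ℝ) 1) := by
  have hmul : Measurable fun z : ℝ × ℝ => z.1 * z.2 := by fun_prop
  have hprod := (indepFun_iff_map_prod_eq_prod_map_map hB.aemeasurable hU.aemeasurable).1 hindep
  have hcomp : Measure.map (fun ω => B ω * U ω) P
      = Measure.map (fun z : ℝ × ℝ => z.1 * z.2) (Measure.map (fun ω => (B ω, U ω)) P) := by
    rw [Measure.map_map hmul (hB.prodMk hU)]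
    rfl
  rw [hcomp, hprod, hBlaw, hUlaw, Measure.add_prod, Measure.map_add _ _ hmul,
    Measure.prod_smul_left, Measure.prod_smul_left, Measure.map_smul, Measure.map_smul,
    Measure.dirac_prod, Measure.dirac_prod, Measure.map_map hmul (by fun_prop),
    Measure.map_map hmul (by fun_prop)]
  simp [Function.comp_def, Measure.map_const]

/-- Expectation of a continuous function of a variable with the boundary inflated uniform law. -/
theorem integral_comp_of_map_eq_biu {Ω : Type*} [MeasurableSpace Ω] {P : Measure Ω}
    {p : ℝ} (hp0 : 0 ≤ p) (hp1 : p ≤ 1) {X : Ω → ℝ} (hX : Measurable X)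
    (hXlaw : Measure.map X P
      = ENNReal.ofReal (1 - p) • Measure.dirac 0
        + ENNReal.ofReal p • volume.restrict (Set.Icc (0 : ℝ) 1))
    {f : ℝ → ℝ} (hf : Continuous f) :
    ∫ ω, f (X ω) ∂P = (1 - p) * f 0 + p * ∫ x in (0 : ℝ)..1, f x := by
  have hint : Integrable f (volume.restrict (Set.Icc (0 : ℝ) 1)) :=
    hf.continuousOn.integrableOn_compact isCompact_Icc
  rw [← integral_map hX.aemeasurable hf.aestronglyMeasurable, hXlaw,
    integral_add_measure ((integrable_dirac (by simp)).smul_measure ENNReal.ofReal_ne_top)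
      (hint.smul_measure ENNReal.ofReal_ne_top),
    integral_smul_measure, integral_smul_measure, integral_dirac,
    ENNReal.toReal_ofReal (by linarith), ENNReal.toReal_ofReal hp0,
    integral_Icc_eq_integral_Ioc, ← intervalIntegral.integral_of_le zero_le_one]
  simp

/-- Moments about a point `m` of the boundary inflated uniform law. -/
theorem integral_sub_pow_of_map_eq_biu {Ω : Type*} [MeasurableSpace Ω] {P : Measure Ω}
    {p : ℝ} (hp0 : 0 ≤ p) (hp1 : p ≤ 1) {X : Ω → ℝ} (hX : Measurable X)
    (hXlaw : Measure.map X P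
      = ENNReal.ofReal (1 - p) • Measure.dirac 0
        + ENNReal.ofReal p • volume.restrict (Set.Icc (0 : ℝ) 1))
    (m : ℝ) (k : ℕ) :
    ∫ ω, (X ω - m) ^ k ∂P
      = (1 - p) * (-m) ^ k + p * (((1 - m) ^ (k + 1) - (-m) ^ (k + 1)) / (k + 1)) := by
  rw [integral_comp_of_map_eq_biu hp0 hp1 hX hXlaw (f := fun x => (x - m) ^ k) (by fun_prop),
    intervalIntegral.integral_comp_sub_right (fun x => x ^ k), integral_pow]
  simp

/-- **Limit variance of the test statistic under the BIU(p) distribution.** -/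
theorem biu_limit_variance
    {Ω : Type*} [MeasurableSpace Ω] (P : Measure Ω) [IsProbabilityMeasure P]
    (p : ℝ) (hp0 : 0 < p) (hp1 : p < 1)
    (B U : Ω → ℝ) (hB : Measurable B) (hU : Measurable U)
    (hindep : IndepFun B U P)
    (hBlaw : Measure.map B P
      = ENNReal.ofReal (1 - p) • Measure.dirac 0 + ENNReal.ofReal p • Measure.dirac 1)
    (hUlaw : Measure.map U P = volume.restrict (Set.Icc (0 : ℝ) 1))
    (X : Ω → ℝ) (hX : X = fun ω => B ω * U ω)
    (ν : ℕ → ℝ)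
    (hν : ∀ k, ν k = ∫ ω, ((X ω - ∫ ω', X ω' ∂P)
        / Real.sqrt (∫ ω', (X ω' - ∫ ω'', X ω'' ∂P) ^ 2 ∂P)) ^ k ∂P)
    (Δ : ℝ) (hΔ : Δ = ν 4 - ν 3 ^ 2) :
    4 * Δ ^ 3 - Δ ^ 2
      - (3 * ν 3 ^ 4 + 16 * ν 3 ^ 2 - 8 * ν 3 * ν 5 + 4 * ν 6) * Δ
      + ν 3 ^ 6 - 4 * ν 3 ^ 4 - 4 * ν 3 ^ 3 * ν 5 + 2 * ν 3 ^ 2 * (2 + 3 * ν 6)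
      + 4 * ν 3 * (ν 5 - ν 7) + ν 8
    = 1152 * (2446 - 11229 * p + 21744 * p ^ 2 - 22080 * p ^ 3
        + 11640 * p ^ 4 - 2520 * p ^ 5) / (875 * p ^ 3 * (4 - 3 * p) ^ 8) := by
  have hXm : Measurable X := by
    rw [hX]
    exact hB.mul hU
  have hXlaw := map_bernoulli_mul_uniform hB hU hindep hBlaw hUlaw
  rw [← hX] at hXlaw
  have hmom := integral_sub_pow_of_map_eq_biu hp0.le hp1.le hXm hXlaw
  have hmean : ∫ ω, X ω ∂P = p / 2 := by
    have h := hmom 0 1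
    norm_num at h
    linarith
  rw [hmean] at hν
  have hvar : ∫ ω, (X ω - p / 2) ^ 2 ∂P = p * (4 - 3 * p) / 12 := by
    rw [hmom]
    push_cast
    ring
  rw [hvar] at hν
  have hq : 0 < 4 - 3 * p := by linarith
  obtain ⟨s, hs⟩ : ∃ s, s = Real.sqrt (p * (4 - 3 * p) / 12) := ⟨_, rfl⟩
  have hs2 : s ^ 2 = p * (4 - 3 * p) / 12 := by
    rw [hs, Real.sq_sqrt (by positivity)]
  have hν' : ∀ k, ν k = ((1 - p) * (-(p / 2)) ^ k
      + p * (((1 - p / 2) ^ (k + 1) - (-(p / 2)) ^ (k + 1)) / (k + 1))) / s ^ k := by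
    intro k
    rw [hν, ← hs, ← hmom]
    simp_rw [div_pow]
    rw [integral_div]
  have e4 : s ^ 4 = (p * (4 - 3 * p) / 12) ^ 2 := by rw [← hs2]; ring
  have e6 : s ^ 6 = (p * (4 - 3 * p) / 12) ^ 3 := by rw [← hs2]; ring
  have e8 : s ^ 8 = (p * (4 - 3 * p) / 12) ^ 4 := by rw [← hs2]; ring
  have hpair : ∀ a b x y : ℝ, ∀ i j n : ℕ, i + j = 2 * n → x = a / s ^ i → y = b / s ^ j →
      x * y = a * b / (p * (4 - 3 * p) / 12) ^ n := by
    rintro a b x y i j n h rfl rfl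
    rw [div_mul_div_comm, ← pow_add, h, pow_mul, hs2]
  have h33 := hpair _ _ _ _ 3 3 3 rfl (hν' 3) (hν' 3)
  have h35 := hpair _ _ _ _ 3 5 4 rfl (hν' 3) (hν' 5)
  have h37 := hpair _ _ _ _ 3 7 5 rfl (hν' 3) (hν' 7)
  have h4 := hν' 4
  have h6 := hν' 6
  have h8 := hν' 8
  rw [e4] at h4
  rw [e6] at h6
  rw [e8] at h8
  have hgroup : 4 * Δ ^ 3 - Δ ^ 2
      - (3 * ν 3 ^ 4 + 16 * ν 3 ^ 2 - 8 * ν 3 * ν 5 + 4 * ν 6) * Δ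
      + ν 3 ^ 6 - 4 * ν 3 ^ 4 - 4 * ν 3 ^ 3 * ν 5 + 2 * ν 3 ^ 2 * (2 + 3 * ν 6)
      + 4 * ν 3 * (ν 5 - ν 7) + ν 8
      = 4 * (ν 4 - ν 3 * ν 3) ^ 3 - (ν 4 - ν 3 * ν 3) ^ 2
        - (3 * (ν 3 * ν 3) ^ 2 + 16 * (ν 3 * ν 3) - 8 * (ν 3 * ν 5) + 4 * ν 6)
          * (ν 4 - ν 3 * ν 3)
        + (ν 3 * ν 3) ^ 3 - 4 * (ν 3 * ν 3) ^ 2 - 4 * (ν 3 * ν 3) * (ν 3 * ν 5)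
        + 2 * (ν 3 * ν 3) * (2 + 3 * ν 6) + 4 * (ν 3 * ν 5) - 4 * (ν 3 * ν 7) + ν 8 := by
    rw [hΔ]
    ring
  rw [hgroup, h33, h35, h37, h4, h6, h8]
  have hp : p ≠ 0 := hp0.ne'
  have hq' : 4 - 3 * p ≠ 0 := hq.ne'
  obtain ⟨q, hqp⟩ : ∃ q, q = 4 - 3 * p := ⟨_, rfl⟩
  rw [← hqp] at hq' ⊢
  push_cast
  field_simp
  rw [hqp]
  ring
end

section
/- Let 0 < p < 1 and d > 0, and let f_{p,d}(x) = (1−p)φ(x) + pφ(x−d) be the density of the mixture MN(p,d) of two normal distributions with variance 1 and means 0 and d, where φ is the standard normal density. If (min(p, 1−p)) · exp(d²/8) ≥ 1, then f_{p,d} is bimodal; in particular, f_{p,d}(0) > f_{p,d}(d/2) and f_{p,d}(d/2) < f_{p,d}(d). -/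
open Real

/-- **Bimodality of the two-component normal mixture.**  If
`min(p, 1−p)·exp(d²/8) ≥ 1`, then the density `f_{p,d} = (1−p)φ + pφ(·−d)` is bimodal,
witnessed by `f_{p,d}(0) > f_{p,d}(d/2)` and `f_{p,d}(d/2) < f_{p,d}(d)`. -/
theorem mixed_normal_bimodal
    (p d : ℝ) (hp0 : 0 < p) (hp1 : p < 1) (hd : 0 < d)
    (φ : ℝ → ℝ) (hφ : φ = fun x => (Real.sqrt (2 * π))⁻¹ * Real.exp (-x ^ 2 / 2))
    (f : ℝ → ℝ) (hf : f = fun x => (1 - p) * φ x + p * φ (x - d))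
    (h : min p (1 - p) * Real.exp (d ^ 2 / 8) ≥ 1) :
    (∃ a b c : ℝ, a < b ∧ b < c ∧ f a > f b ∧ f b < f c) ∧
    f 0 > f (d / 2) ∧ f (d / 2) < f d := by
  have hc : 0 < (Real.sqrt (2 * π))⁻¹ := by positivity
  have hE : Real.exp (-(d ^ 2 / 8)) * Real.exp (d ^ 2 / 8) = 1 := by
    rw [← Real.exp_add, neg_add_cancel, Real.exp_zero]
  have hmin : Real.exp (-(d ^ 2 / 8)) ≤ min p (1 - p) :=
    le_of_mul_le_mul_right (hE.trans_le h) (Real.exp_pos _)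
  obtain ⟨hp, hq⟩ := le_min_iff.mp hmin
  have hmid : f (d / 2) = (Real.sqrt (2 * π))⁻¹ * Real.exp (-(d ^ 2 / 8)) := by
    simp only [hf, hφ]
    rw [show -(d / 2) ^ 2 / 2 = -(d ^ 2 / 8) by ring,
      show -(d / 2 - d) ^ 2 / 2 = -(d ^ 2 / 8) by ring]
    ring
  have hzero : f 0 = (Real.sqrt (2 * π))⁻¹ * ((1 - p) + p * Real.exp (-d ^ 2 / 2)) := by
    simp only [hf, hφ]
    rw [show -(0 : ℝ) ^ 2 / 2 = 0 by ring, show -(0 - d) ^ 2 / 2 = -d ^ 2 / 2 by ring,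
      Real.exp_zero]
    ring
  have hright : f d = (Real.sqrt (2 * π))⁻¹ * ((1 - p) * Real.exp (-d ^ 2 / 2) + p) := by
    simp only [hf, hφ]
    rw [show -(d - d) ^ 2 / 2 = 0 by ring, Real.exp_zero]
    ring
  have hleft_gt : f 0 > f (d / 2) := by
    rw [hzero, hmid]
    exact mul_lt_mul_of_pos_left
      (by linarith [mul_pos hp0 (Real.exp_pos (-d ^ 2 / 2))]) hc
  have hright_gt : f (d / 2) < f d := by
    rw [hright, hmid]
    exact mul_lt_mul_of_pos_left
      (by linarith [mul_pos (sub_pos.mpr hp1) (Real.exp_pos (-d ^ 2 / 2))]) hc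
  exact ⟨⟨0, d / 2, d, half_pos hd, half_lt_self hd, hleft_gt, hright_gt⟩, hleft_gt, hright_gt⟩
end

section
/- Let 0 < p < 1 and d > 0, and let X have the MN(p,d) distribution. Then its kurtosis equals κ(p,d) = 3 + d⁴ · p(1−p)(1 − 6p(1−p)) / (1 + d²p(1−p))². -/
open MeasureTheory ProbabilityTheory

lemma integrable_add_const_pow_stdGaussian (n : ℕ) (c : ℝ) :
    Integrable (fun x : ℝ => (x + c) ^ n) (gaussianReal 0 1) := by
  have h : MemLp (fun x : ℝ => x + c) n (gaussianReal 0 1) :=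
    (memLp_id_gaussianReal n).add (memLp_const c)
  have hm : Measurable (fun x : ℝ => (x + c) ^ n) := by fun_prop
  rw [← integrable_norm_iff hm.aestronglyMeasurable]
  simpa only [norm_pow] using h.integrable_norm_pow'

lemma integrable_pow_stdGaussian (n : ℕ) :
    Integrable (fun x : ℝ => x ^ n) (gaussianReal 0 1) := by
  simpa using integrable_add_const_pow_stdGaussian n 0

lemma integral_pow_stdGaussian (n : ℕ) :
    ∫ x, x ^ n ∂gaussianReal 0 1 = iteratedDeriv n (fun t : ℝ => Real.exp (t ^ 2 / 2)) 0 := by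
  have h := iteratedDeriv_mgf_zero (X := fun x : ℝ => x) (μ := gaussianReal 0 1) (by simp) n
  rw [mgf_fun_id_gaussianReal] at h
  simpa using h.symm

lemma deriv_mul_exp_half_sq {q r : ℝ → ℝ} (hq : ∀ t, HasDerivAt q (r t) t) :
    deriv (fun t : ℝ => q t * Real.exp (t ^ 2 / 2))
      = fun t => (r t + t * q t) * Real.exp (t ^ 2 / 2) := by
  funext t
  have h : HasDerivAt (fun t : ℝ => t ^ 2 / 2) t t := by
    simpa using (hasDerivAt_pow 2 t).div_const 2
  rw [((hq t).fun_mul h.exp).deriv]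
  ring

lemma iteratedDeriv_exp_half_sq :
    iteratedDeriv 1 (fun t : ℝ => Real.exp (t ^ 2 / 2))
        = (fun t => t * Real.exp (t ^ 2 / 2)) ∧
      iteratedDeriv 2 (fun t : ℝ => Real.exp (t ^ 2 / 2))
        = (fun t => (1 + t ^ 2) * Real.exp (t ^ 2 / 2)) ∧
      iteratedDeriv 3 (fun t : ℝ => Real.exp (t ^ 2 / 2))
        = (fun t => (3 * t + t ^ 3) * Real.exp (t ^ 2 / 2)) ∧
      iteratedDeriv 4 (fun t : ℝ => Real.exp (t ^ 2 / 2))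
        = (fun t => (3 + 6 * t ^ 2 + t ^ 4) * Real.exp (t ^ 2 / 2)) := by
  have h1 : iteratedDeriv 1 (fun t : ℝ => Real.exp (t ^ 2 / 2))
      = (fun t => t * Real.exp (t ^ 2 / 2)) := by
    rw [iteratedDeriv_one]
    simpa using deriv_mul_exp_half_sq (fun t => hasDerivAt_const t (1 : ℝ))
  have h2 : iteratedDeriv 2 (fun t : ℝ => Real.exp (t ^ 2 / 2))
      = (fun t => (1 + t ^ 2) * Real.exp (t ^ 2 / 2)) := by
    rw [iteratedDeriv_succ, h1, deriv_mul_exp_half_sq (fun t => hasDerivAt_id' t)]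
    funext t
    ring
  have h3 : iteratedDeriv 3 (fun t : ℝ => Real.exp (t ^ 2 / 2))
      = (fun t => (3 * t + t ^ 3) * Real.exp (t ^ 2 / 2)) := by
    rw [iteratedDeriv_succ, h2,
      deriv_mul_exp_half_sq (fun t => (hasDerivAt_pow 2 t).const_add 1)]
    funext t
    norm_num
    ring
  refine ⟨h1, h2, h3, ?_⟩
  rw [iteratedDeriv_succ, h3,
    deriv_mul_exp_half_sq (fun t => ((hasDerivAt_id' t).const_mul 3).fun_add (hasDerivAt_pow 3 t))]
  funext t
  norm_num
  ring

lemma integral_add_const_stdGaussian (c : ℝ) :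
    ∫ x, (x + c) ∂gaussianReal 0 1 = c := by
  have h := integrable_pow_stdGaussian 1
  simp only [pow_one] at h
  rw [integral_add h (integrable_const c)]
  simp

lemma integral_add_const_sq_stdGaussian (c : ℝ) :
    ∫ x, (x + c) ^ 2 ∂gaussianReal 0 1 = 1 + c ^ 2 := by
  obtain ⟨h1, h2, -, -⟩ := iteratedDeriv_exp_half_sq
  have i (n : ℕ) (a : ℝ) := (integrable_pow_stdGaussian n).const_mul a
  have e (x : ℝ) : (x + c) ^ 2 = 1 * x ^ 2 + 2 * c * x ^ 1 + c ^ 2 * x ^ 0 := by ring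
  simp_rw [e]
  rw [integral_add ((i _ _).fun_add (i _ _)) (i _ _), integral_add (i _ _) (i _ _)]
  simp only [integral_const_mul, integral_pow_stdGaussian, h1, h2]
  norm_num

lemma integral_add_const_pow_four_stdGaussian (c : ℝ) :
    ∫ x, (x + c) ^ 4 ∂gaussianReal 0 1 = 3 + 6 * c ^ 2 + c ^ 4 := by
  obtain ⟨h1, h2, h3, h4⟩ := iteratedDeriv_exp_half_sq
  have i (n : ℕ) (a : ℝ) := (integrable_pow_stdGaussian n).const_mul a
  have e (x : ℝ) : (x + c) ^ 4
      = 1 * x ^ 4 + 4 * c * x ^ 3 + 6 * c ^ 2 * x ^ 2 + 4 * c ^ 3 * x ^ 1 + c ^ 4 * x ^ 0 := by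
    ring
  simp_rw [e]
  rw [integral_add ((((i _ _).fun_add (i _ _)).fun_add (i _ _)).fun_add (i _ _)) (i _ _),
    integral_add (((i _ _).fun_add (i _ _)).fun_add (i _ _)) (i _ _),
    integral_add ((i _ _).fun_add (i _ _)) (i _ _), integral_add (i _ _) (i _ _)]
  simp only [integral_const_mul, integral_pow_stdGaussian, h1, h2, h3, h4]
  norm_num

/-- Powers of a shifted normal mixture are integrated by conditioning on the Bernoulli variable. -/
lemma integral_normal_mixture_pow
    {Ω : Type*} [MeasurableSpace Ω] {P : Measure Ω} [IsProbabilityMeasure P]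
    {p : ℝ} (hp0 : 0 ≤ p) (hp1 : p ≤ 1) {N B : Ω → ℝ} (hN : Measurable N) (hB : Measurable B)
    (hindep : IndepFun N B P) (hNlaw : Measure.map N P = gaussianReal 0 1)
    (hBlaw : Measure.map B P
      = ENNReal.ofReal (1 - p) • Measure.dirac 0 + ENNReal.ofReal p • Measure.dirac 1)
    (d c : ℝ) (n : ℕ) :
    ∫ ω, (N ω + d * B ω + c) ^ n ∂P
      = (1 - p) * ∫ x, (x + c) ^ n ∂gaussianReal 0 1
        + p * ∫ x, (x + (d + c)) ^ n ∂gaussianReal 0 1 := by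
  have hlaw := (indepFun_iff_map_prod_eq_prod_map_map hN.aemeasurable hB.aemeasurable).1 hindep
  have hm : Measurable (fun z : ℝ × ℝ => (z.1 + d * z.2 + c) ^ n) := by fun_prop
  have hpush : ∫ ω, (N ω + d * B ω + c) ^ n ∂P
      = ∫ z, (z.1 + d * z.2 + c) ^ n ∂(P.map fun ω => (N ω, B ω)) :=
    (integral_map (hN.prodMk hB).aemeasurable hm.aestronglyMeasurable).symm
  have hslice (b : ℝ) : Measurable (fun x : ℝ => (x, b)) := by fun_prop
  have hint (b : ℝ) : Integrable (fun z : ℝ × ℝ => (z.1 + d * z.2 + c) ^ n)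
      ((gaussianReal 0 1).map fun x => (x, b)) := by
    rw [integrable_map_measure hm.aestronglyMeasurable (hslice b).aemeasurable]
    simpa [Function.comp_def, add_assoc] using integrable_add_const_pow_stdGaussian n (d * b + c)
  have hval (b : ℝ) : ∫ z, (z.1 + d * z.2 + c) ^ n ∂((gaussianReal 0 1).map fun x => (x, b))
      = ∫ x, (x + (d * b + c)) ^ n ∂gaussianReal 0 1 := by
    rw [integral_map (hslice b).aemeasurable hm.aestronglyMeasurable]
    simp only [add_assoc]
  rw [hpush, hlaw, hNlaw, hBlaw, Measure.prod_add, Measure.prod_smul_right,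
    Measure.prod_smul_right, Measure.prod_dirac, Measure.prod_dirac,
    integral_add_measure ((hint 0).smul_measure ENNReal.ofReal_ne_top)
      ((hint 1).smul_measure ENNReal.ofReal_ne_top),
    integral_smul_measure, integral_smul_measure, hval, hval,
    ENNReal.toReal_ofReal (sub_nonneg.2 hp1), ENNReal.toReal_ofReal hp0]
  simp

/-- **Kurtosis of the normal mixture MN(p,d).** -/
theorem mixed_normal_kurtosis
    {Ω : Type*} [MeasurableSpace Ω] (P : Measure Ω) [IsProbabilityMeasure P]
    (p d : ℝ) (hp0 : 0 < p) (hp1 : p < 1) (hd : 0 < d)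
    (N B : Ω → ℝ) (hN : Measurable N) (hB : Measurable B)
    (hindep : IndepFun N B P)
    (hNlaw : Measure.map N P = gaussianReal 0 1)
    (hBlaw : Measure.map B P
      = ENNReal.ofReal (1 - p) • Measure.dirac 0 + ENNReal.ofReal p • Measure.dirac 1)
    (X : Ω → ℝ) (hX : X = fun ω => N ω + d * B ω) :
    (∫ ω, (X ω - ∫ ω', X ω' ∂P) ^ 4 ∂P)
        / (∫ ω', (X ω' - ∫ ω'', X ω'' ∂P) ^ 2 ∂P) ^ 2
      = 3 + d ^ 4 * (p * (1 - p) * (1 - 6 * p * (1 - p)))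
          / (1 + d ^ 2 * p * (1 - p)) ^ 2 := by
  have hpow (c : ℝ) (n : ℕ) :=
    integral_normal_mixture_pow hp0.le hp1.le hN hB hindep hNlaw hBlaw d c n
  have hmean : ∫ ω, X ω ∂P = d * p := by
    have h := hpow 0 1
    simp only [pow_one, integral_add_const_stdGaussian] at h
    simp only [add_zero] at h
    rw [hX, h]
    ring
  have hcentral (n : ℕ) : ∫ ω, (X ω - d * p) ^ n ∂P
      = (1 - p) * ∫ x, (x + -(d * p)) ^ n ∂gaussianReal 0 1
        + p * ∫ x, (x + (d + -(d * p))) ^ n ∂gaussianReal 0 1 := by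
    rw [hX, ← hpow]
    simp only [sub_eq_add_neg]
  have hvar : 1 + d ^ 2 * p * (1 - p) ≠ 0 := by
    have : 0 < 1 - p := sub_pos.2 hp1
    positivity
  have hsq : (1 - p) * (1 + (-(d * p)) ^ 2) + p * (1 + (d + -(d * p)) ^ 2)
      = 1 + d ^ 2 * p * (1 - p) := by ring
  rw [hmean, hcentral, hcentral, integral_add_const_sq_stdGaussian,
    integral_add_const_sq_stdGaussian, integral_add_const_pow_four_stdGaussian,
    integral_add_const_pow_four_stdGaussian, hsq]
  rw [div_eq_iff (pow_ne_zero 2 hvar), add_mul, div_mul_cancel₀ _ (pow_ne_zero 2 hvar)]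
  ring
end

section
/- Let 0 < p < 1 and d > 0, and let X have the MN(p,d) distribution with skewness τ(p,d) and kurtosis κ(p,d). Then the kurtosis-minus-squared-skewness parameter equals Δ(p,d) = κ(p,d) − τ(p,d)² = 3 + d⁴ p(1−p) · (1 − 6p(1−p) − 2d²p²(1−p)²) / (1 + d²p(1−p))³. -/
open MeasureTheory ProbabilityTheory
open scoped NNReal

/-- The moments of a Gaussian are the derivatives at zero of its moment generating function. -/
lemma integral_pow_gaussianReal_eq_iteratedDeriv (μ : ℝ) (v : ℝ≥0) (n : ℕ) :
    ∫ x, x ^ n ∂gaussianReal μ v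
      = iteratedDeriv n (fun t : ℝ => Real.exp (μ * t + v * t ^ 2 / 2)) 0 := by
  rw [← mgf_id_gaussianReal, iteratedDeriv_mgf_zero (by simp)]
  simp

lemma hasDerivAt_mul_exp_quadratic {f : ℝ → ℝ} {f' : ℝ} (μ v t : ℝ) (hf : HasDerivAt f f' t) :
    HasDerivAt (fun t => f t * Real.exp (μ * t + v * t ^ 2 / 2))
      ((f' + f t * (μ + v * t)) * Real.exp (μ * t + v * t ^ 2 / 2)) t := by
  have h : HasDerivAt (fun t : ℝ => μ * t + v * t ^ 2 / 2) (μ + v * t) t :=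
    (((hasDerivAt_id t).const_mul μ).add
      ((((hasDerivAt_id t).pow 2).const_mul v).div_const 2)).congr_deriv (by simp; ring)
  exact (hf.mul h.exp).congr_deriv (by ring)

lemma iteratedDeriv_one_exp_quadratic (μ v : ℝ) :
    iteratedDeriv 1 (fun t : ℝ => Real.exp (μ * t + v * t ^ 2 / 2))
      = fun t => (μ + v * t) * Real.exp (μ * t + v * t ^ 2 / 2) := by
  funext t
  rw [iteratedDeriv_one]
  simpa using (hasDerivAt_mul_exp_quadratic μ v t (hasDerivAt_const t (1 : ℝ))).deriv

lemma hasDerivAt_add_mul (μ v t : ℝ) : HasDerivAt (fun t => μ + v * t) v t := by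
  simpa using ((hasDerivAt_id t).const_mul v).const_add μ

lemma iteratedDeriv_two_exp_quadratic (μ v : ℝ) :
    iteratedDeriv 2 (fun t : ℝ => Real.exp (μ * t + v * t ^ 2 / 2))
      = fun t => ((μ + v * t) ^ 2 + v) * Real.exp (μ * t + v * t ^ 2 / 2) := by
  funext t
  rw [iteratedDeriv_succ, iteratedDeriv_one_exp_quadratic,
    (hasDerivAt_mul_exp_quadratic μ v t (hasDerivAt_add_mul μ v t)).deriv]
  ring

lemma iteratedDeriv_three_exp_quadratic (μ v : ℝ) :
    iteratedDeriv 3 (fun t : ℝ => Real.exp (μ * t + v * t ^ 2 / 2))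
      = fun t => ((μ + v * t) ^ 3 + 3 * v * (μ + v * t)) *
          Real.exp (μ * t + v * t ^ 2 / 2) := by
  funext t
  have h := hasDerivAt_add_mul μ v t
  rw [iteratedDeriv_succ, iteratedDeriv_two_exp_quadratic,
    (hasDerivAt_mul_exp_quadratic μ v t ((h.fun_pow 2).add_const v)).deriv]
  push_cast
  ring

lemma iteratedDeriv_four_exp_quadratic (μ v : ℝ) :
    iteratedDeriv 4 (fun t : ℝ => Real.exp (μ * t + v * t ^ 2 / 2))
      = fun t => ((μ + v * t) ^ 4 + 6 * v * (μ + v * t) ^ 2 + 3 * v ^ 2) *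
          Real.exp (μ * t + v * t ^ 2 / 2) := by
  funext t
  have h := hasDerivAt_add_mul μ v t
  rw [iteratedDeriv_succ, iteratedDeriv_three_exp_quadratic,
    (hasDerivAt_mul_exp_quadratic μ v t ((h.fun_pow 3).fun_add (h.const_mul (3 * v)))).deriv]
  push_cast
  ring

lemma integral_sq_gaussianReal (μ : ℝ) (v : ℝ≥0) :
    ∫ x, x ^ 2 ∂gaussianReal μ v = μ ^ 2 + v := by
  simp [integral_pow_gaussianReal_eq_iteratedDeriv, iteratedDeriv_two_exp_quadratic]

lemma integral_cube_gaussianReal (μ : ℝ) (v : ℝ≥0) :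
    ∫ x, x ^ 3 ∂gaussianReal μ v = μ ^ 3 + 3 * v * μ := by
  simp [integral_pow_gaussianReal_eq_iteratedDeriv, iteratedDeriv_three_exp_quadratic]

lemma integral_pow_four_gaussianReal (μ : ℝ) (v : ℝ≥0) :
    ∫ x, x ^ 4 ∂gaussianReal μ v = μ ^ 4 + 6 * v * μ ^ 2 + 3 * v ^ 2 := by
  simp [integral_pow_gaussianReal_eq_iteratedDeriv, iteratedDeriv_four_exp_quadratic]

lemma integrable_pow_gaussianReal (μ : ℝ) (v : ℝ≥0) (n : ℕ) :
    Integrable (fun x => x ^ n) (gaussianReal μ v) := by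
  simpa using integrable_pow_of_mem_interior_integrableExpSet
    (X := id) (μ := gaussianReal μ v) (by simp) n

lemma integrable_sub_pow_gaussianReal (μ c : ℝ) (v : ℝ≥0) (n : ℕ) :
    Integrable (fun x => (x - c) ^ n) (gaussianReal μ v) := by
  have h := integrable_pow_gaussianReal (μ - c) v n
  rw [← gaussianReal_map_sub_const] at h
  exact h.comp_measurable (measurable_id.sub_const c)

lemma integral_sub_pow_gaussianReal (μ c : ℝ) (v : ℝ≥0) (n : ℕ) :
    ∫ x, (x - c) ^ n ∂gaussianReal μ v = ∫ x, x ^ n ∂gaussianReal (μ - c) v := by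
  rw [← gaussianReal_map_sub_const,
    integral_map (by fun_prop) (by fun_prop)]

/-- The sum of a standard Gaussian and an independent scaled Bernoulli variable is a mixture of
two unit-variance Gaussians. -/
lemma map_gaussian_add_bernoulli {Ω : Type*} [MeasurableSpace Ω] {P : Measure Ω}
    [IsProbabilityMeasure P] {N B : Ω → ℝ} (hN : Measurable N) (hB : Measurable B)
    (hindep : IndepFun N B P) (hNlaw : Measure.map N P = gaussianReal 0 1) {p : ℝ}
    (hBlaw : Measure.map B P
      = ENNReal.ofReal (1 - p) • Measure.dirac 0 + ENNReal.ofReal p • Measure.dirac 1) (d : ℝ) :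
    Measure.map (fun ω => N ω + d * B ω) P
      = ENNReal.ofReal (1 - p) • gaussianReal 0 1 + ENNReal.ofReal p • gaussianReal d 1 := by
  have hd : Measurable fun x : ℝ => d * x := measurable_const_mul d
  have hdB : Measure.map (fun ω => d * B ω) P
      = ENNReal.ofReal (1 - p) • Measure.dirac 0 + ENNReal.ofReal p • Measure.dirac d := by
    have h : Measure.map (fun ω => d * B ω) P = (P.map B).map (fun x => d * x) :=
      (Measure.map_map hd hB).symm
    rw [h, hBlaw, Measure.map_add _ _ hd, Measure.map_smul, Measure.map_smul,
      Measure.map_dirac' hd, Measure.map_dirac' hd]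
    simp
  have hind : IndepFun N (fun ω => d * B ω) P := hindep.comp measurable_id hd
  have h : Measure.map (fun ω => N ω + d * B ω) P = P.map N ∗ P.map (fun ω => d * B ω) :=
    hind.map_add_eq_map_conv_map hN (hd.comp hB)
  rw [h, hNlaw, hdB, Measure.conv_add, Measure.conv_smul_right, Measure.conv_smul_right,
    Measure.conv_dirac, Measure.conv_dirac, gaussianReal_map_add_const,
    gaussianReal_map_add_const]
  simp

/-- Shifted moments of a two-component Gaussian mixture, reduced to Gaussian moments. -/
lemma integral_sub_pow_of_map_eq_gaussian_mixture {Ω : Type*} [MeasurableSpace Ω]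
    {P : Measure Ω} {X : Ω → ℝ} (hX : Measurable X) {p d : ℝ} (hp0 : 0 ≤ p) (hp1 : p ≤ 1)
    (hlaw : Measure.map X P
      = ENNReal.ofReal (1 - p) • gaussianReal 0 1 + ENNReal.ofReal p • gaussianReal d 1)
    (c : ℝ) (n : ℕ) :
    ∫ ω, (X ω - c) ^ n ∂P
      = (1 - p) * ∫ x, x ^ n ∂gaussianReal (-c) 1 + p * ∫ x, x ^ n ∂gaussianReal (d - c) 1 := by
  have h : ∫ ω, (X ω - c) ^ n ∂P = ∫ x, (x - c) ^ n ∂(P.map X) :=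
    (integral_map hX.aemeasurable (f := fun x => (x - c) ^ n) (by fun_prop)).symm
  rw [h, hlaw, integral_add_measure
    ((integrable_sub_pow_gaussianReal _ _ _ _).smul_measure ENNReal.ofReal_ne_top)
    ((integrable_sub_pow_gaussianReal _ _ _ _).smul_measure ENNReal.ofReal_ne_top),
    integral_smul_measure, integral_smul_measure, integral_sub_pow_gaussianReal,
    integral_sub_pow_gaussianReal, ENNReal.toReal_ofReal (sub_nonneg.2 hp1),
    ENNReal.toReal_ofReal hp0, zero_sub, smul_eq_mul, smul_eq_mul]

/-- **Kurtosis minus squared skewness for the normal mixture MN(p,d).** -/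
theorem mixed_normal_kurtosis_minus_squared_skewness
    {Ω : Type*} [MeasurableSpace Ω] (P : Measure Ω) [IsProbabilityMeasure P]
    (p d : ℝ) (hp0 : 0 < p) (hp1 : p < 1) (hd : 0 < d)
    (N B : Ω → ℝ) (hN : Measurable N) (hB : Measurable B)
    (hindep : IndepFun N B P)
    (hNlaw : Measure.map N P = gaussianReal 0 1)
    (hBlaw : Measure.map B P
      = ENNReal.ofReal (1 - p) • Measure.dirac 0 + ENNReal.ofReal p • Measure.dirac 1)
    (X : Ω → ℝ) (hX : X = fun ω => N ω + d * B ω)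
    (τ κ : ℝ)
    (hτ : τ = (∫ ω, (X ω - ∫ ω', X ω' ∂P) ^ 3 ∂P)
        / (Real.sqrt (∫ ω', (X ω' - ∫ ω'', X ω'' ∂P) ^ 2 ∂P)) ^ 3)
    (hκ : κ = (∫ ω, (X ω - ∫ ω', X ω' ∂P) ^ 4 ∂P)
        / (∫ ω', (X ω' - ∫ ω'', X ω'' ∂P) ^ 2 ∂P) ^ 2) :
    κ - τ ^ 2
      = 3 + d ^ 4 * (p * (1 - p))
          * (1 - 6 * p * (1 - p) - 2 * d ^ 2 * p ^ 2 * (1 - p) ^ 2)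
          / (1 + d ^ 2 * p * (1 - p)) ^ 3 := by
  have hXm : Measurable X := hX ▸ hN.add (hB.const_mul d)
  have hlaw := map_gaussian_add_bernoulli hN hB hindep hNlaw hBlaw d
  rw [← hX] at hlaw
  have hmom := integral_sub_pow_of_map_eq_gaussian_mixture hXm hp0.le hp1.le hlaw
  have hmean : ∫ ω, X ω ∂P = p * d := by
    simpa [integral_id_gaussianReal] using hmom 0 1
  have hV : 0 < 1 + d ^ 2 * p * (1 - p) := by
    have := sub_pos.2 hp1
    positivity
  have hvar : ∫ ω, (X ω - p * d) ^ 2 ∂P = 1 + d ^ 2 * p * (1 - p) := by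
    rw [hmom, integral_sq_gaussianReal, integral_sq_gaussianReal]
    push_cast
    ring
  have hthird : ∫ ω, (X ω - p * d) ^ 3 ∂P = d ^ 3 * p * (1 - p) * (1 - 2 * p) := by
    rw [hmom, integral_cube_gaussianReal, integral_cube_gaussianReal]
    push_cast
    ring
  have hfourth : ∫ ω, (X ω - p * d) ^ 4 ∂P
      = 3 + 6 * d ^ 2 * p * (1 - p) + d ^ 4 * p * (1 - p) * (1 - 3 * p * (1 - p)) := by
    rw [hmom, integral_pow_four_gaussianReal, integral_pow_four_gaussianReal]
    push_cast
    ring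
  rw [hmean, hvar, hthird] at hτ
  rw [hmean, hvar, hfourth] at hκ
  rw [hτ, hκ, div_pow, pow_right_comm, Real.sq_sqrt hV.le]
  field_simp
  ring
end

section
/- Let 0 < p < 1 and d > 0, and let X have the mixed exponential density g_{p,d}(x) = (1−p)e^{−x} + p e^{−(x−d)}1_{[x ≥ d]}, with skewness τ(p,d) and kurtosis κ(p,d). Then Δ(p,d) = κ(p,d) − τ(p,d)² = 5 − d³p(1−p) · (4 − 8p − d(1 − 12p(1−p)) + 4d³p²(1−p)²) / (1 + d²p(1−p))³. -/
open MeasureTheory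

/-- All polynomial moments of the standard exponential density are finite. -/
lemma integrableOn_pow_mul_exp_neg (k : ℕ) :
    IntegrableOn (fun x : ℝ => x ^ k * Real.exp (-x)) (Set.Ioi 0) := by
  refine (Real.GammaIntegral_convergent (s := k + 1) (by positivity)).congr_fun ?_ measurableSet_Ioi
  intro x _
  simp [mul_comm]

lemma integral_pow_mul_exp_neg (k : ℕ) :
    ∫ x in Set.Ioi (0 : ℝ), x ^ k * Real.exp (-x) = k.factorial := by
  rw [← Real.Gamma_nat_eq_factorial, Real.Gamma_eq_integral (by positivity)]
  simp [mul_comm]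

lemma add_pow_mul_exp_neg (c : ℝ) (n : ℕ) (x : ℝ) :
    (x + c) ^ n * Real.exp (-x) =
      ∑ k ∈ Finset.range (n + 1), (c ^ (n - k) * n.choose k) * (x ^ k * Real.exp (-x)) := by
  rw [add_pow, Finset.sum_mul]
  exact Finset.sum_congr rfl fun k _ => by ring

lemma integrableOn_add_pow_mul_exp_neg (c : ℝ) (n : ℕ) :
    IntegrableOn (fun x : ℝ => (x + c) ^ n * Real.exp (-x)) (Set.Ioi 0) := by
  simp only [add_pow_mul_exp_neg]
  exact integrable_finsetSum _ fun k _ => (integrableOn_pow_mul_exp_neg k).const_mul _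

lemma integral_add_pow_mul_exp_neg (c : ℝ) (n : ℕ) :
    ∫ x in Set.Ioi (0 : ℝ), (x + c) ^ n * Real.exp (-x) =
      ∑ k ∈ Finset.range (n + 1), c ^ (n - k) * n.choose k * k.factorial := by
  simp only [add_pow_mul_exp_neg]
  rw [integral_finsetSum _ fun k _ => (integrableOn_pow_mul_exp_neg k).const_mul _]
  simp only [integral_const_mul, integral_pow_mul_exp_neg]

/-- The moments of the mixed exponential distribution about an arbitrary point `m`. -/
lemma integral_sub_pow_mixed_exponential {p d : ℝ} (hp0 : 0 < p) (hp1 : p < 1) (hd : 0 < d)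
    (m : ℝ) (n : ℕ) :
    ∫ x, (x - m) ^ n ∂(volume.withDensity fun x => ENNReal.ofReal
      (if 0 < x then (1 - p) * Real.exp (-x) +
        (if d ≤ x then p * Real.exp (-(x - d)) else 0) else 0)) =
      (1 - p) * ∑ k ∈ Finset.range (n + 1), (-m) ^ (n - k) * n.choose k * k.factorial +
        p * ∑ k ∈ Finset.range (n + 1), (d - m) ^ (n - k) * n.choose k * k.factorial := by
  have hmeas : Measurable fun x : ℝ => if 0 < x then (1 - p) * Real.exp (-x) +
      (if d ≤ x then p * Real.exp (-(x - d)) else 0) else 0 := by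
    refine Measurable.ite measurableSet_Ioi (Measurable.add (by fun_prop) ?_) measurable_const
    exact Measurable.ite measurableSet_Ici (by fun_prop) measurable_const
  have hnonneg : ∀ x : ℝ, 0 ≤ if 0 < x then (1 - p) * Real.exp (-x) +
      (if d ≤ x then p * Real.exp (-(x - d)) else 0) else 0 := by
    intro x
    have : 0 < 1 - p := sub_pos.2 hp1
    split_ifs <;> positivity
  rw [integral_withDensity_eq_integral_toReal_smul hmeas.ennreal_ofReal (by simp),
    ← integral_add_pow_mul_exp_neg, ← integral_add_pow_mul_exp_neg]
  have hshift : ∀ x : ℝ, (Set.Ici d).indicator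
      (fun x => (x - m) ^ n * Real.exp (-(x - d))) x =
      (Set.Ici 0).indicator (fun x => (x + (d - m)) ^ n * Real.exp (-x)) (x - d) := by
    intro x
    by_cases h : d ≤ x <;> simp [Set.indicator, h]
  have hint₀ := integrableOn_add_pow_mul_exp_neg (-m) n
  have hint₁ := (integrableOn_Ici_iff_integrableOn_Ioi (by simp)).2
    (integrableOn_add_pow_mul_exp_neg (d - m) n)
  rw [← integrable_indicator_iff measurableSet_Ioi] at hint₀
  rw [← integrable_indicator_iff measurableSet_Ici] at hint₁
  rw [← integral_Ici_eq_integral_Ioi (f := fun x => (x + (d - m)) ^ n * Real.exp (-x)),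
    ← integral_indicator measurableSet_Ioi, ← integral_indicator measurableSet_Ici,
    ← integral_sub_right_eq_self ((Set.Ici 0).indicator _) d, ← integral_const_mul, ← integral_const_mul,
    ← integral_add (hint₀.const_mul _) ((hint₁.comp_sub_right d).const_mul _)]
  congr 1 with x
  rw [← hshift, ENNReal.toReal_ofReal (hnonneg x), smul_eq_mul]
  by_cases h0 : 0 < x
  · by_cases h : d ≤ x
    · simp only [h0, h, if_true, Set.indicator, Set.mem_Ioi, Set.mem_Ici]
      ring
    · simp only [h0, h, if_true, if_false, Set.indicator, Set.mem_Ioi, Set.mem_Ici]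
      ring
  · have h : ¬ d ≤ x := fun h => h0 (hd.trans_le h)
    simp [h0, h, Set.indicator]

/-- **Kurtosis minus squared skewness for the mixed exponential distribution.** -/
theorem mixed_exponential_kurtosis_minus_squared_skewness
    (p d : ℝ) (hp0 : 0 < p) (hp1 : p < 1) (hd : 0 < d)
    (g : ℝ → ℝ)
    (hg : g = fun x => if 0 < x then
      (1 - p) * Real.exp (-x) + (if d ≤ x then p * Real.exp (-(x - d)) else 0) else 0)
    (μ : Measure ℝ) (hμ : μ = volume.withDensity (fun x => ENNReal.ofReal (g x)))
    (τ κ : ℝ)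
    (hτ : τ = (∫ x, (x - ∫ y, y ∂μ) ^ 3 ∂μ)
        / (Real.sqrt (∫ y, (y - ∫ z, z ∂μ) ^ 2 ∂μ)) ^ 3)
    (hκ : κ = (∫ x, (x - ∫ y, y ∂μ) ^ 4 ∂μ)
        / (∫ y, (y - ∫ z, z ∂μ) ^ 2 ∂μ) ^ 2) :
    κ - τ ^ 2
      = 5 - d ^ 3 * p * (1 - p)
          * (4 - 8 * p - d * (1 - 12 * p * (1 - p)) + 4 * d ^ 3 * p ^ 2 * (1 - p) ^ 2)
          / (1 + d ^ 2 * p * (1 - p)) ^ 3 := by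
  have hmoment (m : ℝ) (n : ℕ) := integral_sub_pow_mixed_exponential hp0 hp1 hd m n
  subst hg
  rw [← hμ] at hmoment
  have hmean : ∫ y, y ∂μ = 1 + p * d := by
    have h := hmoment 0 1
    simp [Finset.sum_range_succ] at h
    rw [h]
    ring
  have hvar : ∫ y, (y - (1 + p * d)) ^ 2 ∂μ = 1 + d ^ 2 * p * (1 - p) := by
    rw [hmoment]
    norm_num [Finset.sum_range_succ, Nat.choose, Nat.factorial]
    ring
  have hthird : ∫ y, (y - (1 + p * d)) ^ 3 ∂μ = 2 + d ^ 3 * p * (1 - p) * (1 - 2 * p) := by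
    rw [hmoment]
    norm_num [Finset.sum_range_succ, Nat.choose, Nat.factorial]
    ring
  have hfourth : ∫ y, (y - (1 + p * d)) ^ 4 ∂μ =
      9 + 6 * d ^ 2 * p * (1 - p) + d ^ 4 * p * (1 - p) * (1 - 3 * p * (1 - p)) := by
    rw [hmoment]
    norm_num [Finset.sum_range_succ, Nat.choose, Nat.factorial]
    ring
  rw [hmean, hvar, hthird] at hτ
  rw [hmean, hvar, hfourth] at hκ
  have hpos : 0 < 1 + d ^ 2 * p * (1 - p) := by
    have : 0 < 1 - p := sub_pos.2 hp1
    positivity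
  rw [hτ, hκ, div_pow, ← pow_mul, mul_comm 3 2, pow_mul, Real.sq_sqrt hpos.le]
  field_simp
  ring
end
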